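/- Let Φ̃ : ℝⁿ → (-∞, ∞] be a proper function, let σ̃ ∈ (0, 1), and let z₀, z₁ be points with z₁ ∈ dom Φ̃. Suppose there exist v₁ and ε₁ ≥ 0 with v₁ ∈ ∂_{ε₁}(Φ̃ + (1/2)‖· − z₀‖²)(z₁) and ‖v₁‖² + 2ε₁ ≤ σ̃²‖v₁ + z₀ − z₁‖². Then for every z ∈ dom Φ̃ and every s > 0, Φ̃(z₁) + (1/2)[1 − σ̃²(1 + 1/s)]·‖v₁ + z₀ − z₁‖² ≤ Φ̃(z) + ((s+1)/2)·‖z − z₀‖². -/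

import Mathlib

open scoped RealInnerProductSpace

/-- Key technical estimate for inexact proximal steps (Lemma A.2 of Melo et al.). -/
theorem stmt_16 (n : ℕ) (Φ : EuclideanSpace ℝ (Fin n) → EReal)
    (hbot : ∀ x, Φ x ≠ ⊥) (hfin : ∃ x, Φ x ≠ ⊤)
    (σt : ℝ) (hσ0 : 0 < σt) (hσ1 : σt < 1)
    (z₀ z₁ : EuclideanSpace ℝ (Fin n)) (hz₁ : Φ z₁ ≠ ⊤)
    (v₁ : EuclideanSpace ℝ (Fin n)) (ε₁ : ℝ) (hε₁ : 0 ≤ ε₁)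
    (hincl : ∀ u, Φ z₁ +
        ((1 / 2 * ‖z₁ - z₀‖ ^ 2 + ⟪v₁, u - z₁⟫ - ε₁ : ℝ) : EReal) ≤
      Φ u + ((1 / 2 * ‖u - z₀‖ ^ 2 : ℝ) : EReal))
    (hrel : ‖v₁‖ ^ 2 + 2 * ε₁ ≤ σt ^ 2 * ‖v₁ + z₀ - z₁‖ ^ 2) :
    ∀ z, Φ z ≠ ⊤ → ∀ s : ℝ, 0 < s →
      Φ z₁ + ((1 / 2 * (1 - σt ^ 2 * (1 + 1 / s)) * ‖v₁ + z₀ - z₁‖ ^ 2 : ℝ) : EReal) ≤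
        Φ z + (((s + 1) / 2 * ‖z - z₀‖ ^ 2 : ℝ) : EReal) := by
  intro z hz s hs
  lift Φ z₁ to ℝ using ⟨hz₁, hbot z₁⟩ with p₁ hp₁
  have hsub := hincl z
  lift Φ z to ℝ using ⟨hz, hbot z⟩ with p hp
  norm_cast at hsub ⊢
  obtain ⟨a, rfl⟩ : ∃ a, z₁ = z₀ + a := ⟨z₁ - z₀, by abel⟩
  obtain ⟨d, rfl⟩ : ∃ d, z = z₀ + d := ⟨z - z₀, by abel⟩
  have hw : v₁ + z₀ - (z₀ + a) = v₁ - a := by abel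
  have hda : z₀ + d - (z₀ + a) = d - a := by abel
  rw [hda, inner_sub_right] at hsub
  rw [hw] at hrel ⊢
  simp only [add_sub_cancel_left] at hsub ⊢
  have hexp := norm_sub_sq_real v₁ a
  have young : 0 ≤ ‖v₁‖ ^ 2 / s + 2 * ⟪v₁, d⟫ + s * ‖d‖ ^ 2 := by
    have hsq : 0 ≤ ‖v₁ + s • d‖ ^ 2 / s := by positivity
    rw [norm_add_sq_real, inner_smul_right, norm_smul, Real.norm_of_nonneg hs.le] at hsq
    convert hsq using 1
    field_simp
  have hv : ‖v₁‖ ^ 2 / s ≤ σt ^ 2 * ‖v₁ - a‖ ^ 2 / s := by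
    gcongr
    linarith
  have hlhs : 1 / 2 * (1 - σt ^ 2 * (1 + 1 / s)) * ‖v₁ - a‖ ^ 2 =
      1 / 2 * ‖v₁ - a‖ ^ 2 - 1 / 2 * (σt ^ 2 * ‖v₁ - a‖ ^ 2)
        - 1 / 2 * (σt ^ 2 * ‖v₁ - a‖ ^ 2 / s) := by ring
  rw [hlhs]
  linarith
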